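/- Let (A^1, …, A^N, r^1, …, r^N) be an N-player finite normal-form game, η > 0, and μ an interior strategy profile. Suppose μ is a Nash equilibrium of the transformed game whose reference policy is μ itself, i.e., for each player i and every mixed strategy p on A^i, V^i(p, μ^{-i}) − η·KL(p, μ^i) ≤ V^i(μ). Then μ is a Nash equilibrium of the original game: V^i(p, μ^{-i}) ≤ V^i(μ) for each i and every mixed strategy p. -/

import Mathlib

open Finset

/-- A probability vector on a finite set: nonnegative entries summing to 1. -/
def IsMixed {α : Type*} [Fintype α] (p : α → ℝ) : Prop :=
  (∀ a, 0 ≤ p a) ∧ ∑ a, p a = 1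

/-- A strictly positive (interior) vector. -/
def IsInterior {α : Type*} [Fintype α] (p : α → ℝ) : Prop :=
  ∀ a, 0 < p a

/-- Kullback–Leibler divergence `KL(p, q) = Σ_a p(a) log(p(a)/q(a))`. -/
noncomputable def KL {α : Type*} [Fintype α] (p q : α → ℝ) : ℝ :=
  ∑ a, p a * Real.log (p a / q a)

/-- Expected payoff `V^i(π)` of player `i` in an N-player finite normal-form game. -/
noncomputable def Vfun {ι : Type*} [Fintype ι] [DecidableEq ι]
    {A : ι → Type*} [∀ i, Fintype (A i)]
    (r : (∀ j, A j) → ℝ) (π : ∀ j, A j → ℝ) : ℝ :=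
  ∑ a : ∀ j, A j, (∏ j, π j (a j)) * r a

/-- The KL divergence is bounded by the chi-squared divergence. -/
theorem KL_le_sum_sq_div {α : Type*} [Fintype α] {p q : α → ℝ}
    (hp : IsMixed p) (hq : IsMixed q) (hqI : IsInterior q) :
    KL p q ≤ ∑ a, (p a - q a) ^ 2 / q a := by
  have hterm : ∀ a, p a * Real.log (p a / q a) ≤ (p a - q a) ^ 2 / q a + (p a - q a) := by
    intro a
    have hqa := hqI a
    have heq : (p a - q a) ^ 2 / q a + (p a - q a) = p a * (p a / q a - 1) := by
      field_simp
      ring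
    rw [heq]
    rcases (hp.1 a).eq_or_lt with h | h
    · simp [← h]
    · exact mul_le_mul_of_nonneg_left (Real.log_le_sub_one_of_pos (div_pos h hqa)) h.le
  calc KL p q ≤ ∑ a, ((p a - q a) ^ 2 / q a + (p a - q a)) := sum_le_sum fun a _ => hterm a
    _ = ∑ a, (p a - q a) ^ 2 / q a := by
      rw [sum_add_distrib, sum_sub_distrib, hp.2, hq.2, sub_self, add_zero]

/-- The expected payoff is affine in each player's own strategy. -/
theorem Vfun_update_add_mul_sub {ι : Type*} [Fintype ι] [DecidableEq ι]
    {A : ι → Type*} [∀ i, Fintype (A i)] (r : (∀ j, A j) → ℝ) (μ : ∀ j, A j → ℝ)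
    (i : ι) (p : A i → ℝ) (t : ℝ) :
    Vfun r (Function.update μ i fun a => μ i a + t * (p a - μ i a)) =
      Vfun r μ + t * (Vfun r (Function.update μ i p) - Vfun r μ) := by
  have hprod : ∀ (q : A i → ℝ) (a : ∀ j, A j),
      ∏ j, Function.update μ i q j (a j) = q (a i) * ∏ j ∈ univ.erase i, μ j (a j) := by
    intro q a
    rw [← mul_prod_erase univ _ (mem_univ i), Function.update_self]
    congr 1
    refine prod_congr rfl fun j hj => ?_
    rw [Function.update_of_ne (ne_of_mem_erase hj)]
  have hV : ∀ q : A i → ℝ, Vfun r (Function.update μ i q) =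
      ∑ a : ∀ j, A j, q (a i) * (∏ j ∈ univ.erase i, μ j (a j)) * r a := by
    intro q
    simp only [Vfun, hprod]
  have hμ := hV (μ i)
  rw [Function.update_eq_self] at hμ
  rw [hV, hV, hμ, ← sum_sub_distrib, mul_sum, ← sum_add_distrib]
  exact sum_congr rfl fun a _ => by ring

/-- Moving from one mixed strategy towards another gives a mixed strategy. -/
theorem IsMixed.add_mul_sub {α : Type*} [Fintype α] {p q : α → ℝ}
    (hp : IsMixed p) (hq : IsMixed q) {t : ℝ} (ht0 : 0 ≤ t) (ht1 : t ≤ 1) :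
    IsMixed fun a => q a + t * (p a - q a) := by
  refine ⟨fun a => ?_, ?_⟩
  · have h1 := mul_nonneg ht0 (hp.1 a)
    have h2 := mul_nonneg (sub_nonneg.2 ht1) (hq.1 a)
    linarith
  · rw [sum_add_distrib, ← mul_sum, sum_sub_distrib, hp.2, hq.2]
    ring

/-- A fixed point of the iterated-regularization map is a Nash equilibrium of the
original game: if `μ` is interior and is a Nash equilibrium of the transformed game
whose reference policy is `μ` itself, then `μ` is a Nash equilibrium of the
original game. -/
theorem fixed_point_is_nash
    {ι : Type*} [Fintype ι] [DecidableEq ι]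
    {A : ι → Type*} [∀ i, Fintype (A i)] [∀ i, Nonempty (A i)]
    (r : ι → (∀ j, A j) → ℝ)
    (η : ℝ) (hη : 0 < η)
    (μ : ∀ j, A j → ℝ) (hμ : ∀ i, IsMixed (μ i)) (hμI : ∀ i, IsInterior (μ i))
    (hfix : ∀ i (p : A i → ℝ), IsMixed p →
      Vfun (r i) (Function.update μ i p) - η * KL p (μ i) ≤ Vfun (r i) μ) :
    ∀ i (p : A i → ℝ), IsMixed p →
      Vfun (r i) (Function.update μ i p) ≤ Vfun (r i) μ := by
  intro i p hp
  set D := Vfun (r i) (Function.update μ i p) - Vfun (r i) μ with hD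
  set C := ∑ a, (p a - μ i a) ^ 2 / μ i a with hC
  have hC0 : 0 ≤ C := sum_nonneg fun a _ => div_nonneg (sq_nonneg _) (hμI i a).le
  have key : ∀ t : ℝ, 0 < t → t ≤ 1 → D ≤ η * C * t := by
    intro t ht0 ht1
    have hmix := hp.add_mul_sub (hμ i) ht0.le ht1
    have hopt := hfix i _ hmix
    have hKL := KL_le_sum_sq_div hmix (hμ i) (hμI i)
    have hsum : ∑ a, (μ i a + t * (p a - μ i a) - μ i a) ^ 2 / μ i a = t ^ 2 * C := by
      rw [hC, mul_sum]
      exact sum_congr rfl fun a _ => by ring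
    rw [hsum] at hKL
    rw [Vfun_update_add_mul_sub, ← hD] at hopt
    have hKLη := mul_le_mul_of_nonneg_left hKL hη.le
    refine le_of_mul_le_mul_left ?_ ht0
    linarith
  by_contra! hlt
  have hDpos : 0 < D := sub_pos.2 hlt
  have hηC : 0 ≤ η * C := mul_nonneg hη.le hC0
  have hden : 0 < η * C + D := by linarith
  have h := key (D / (η * C + D)) (div_pos hDpos hden) ((div_le_one hden).2 (by linarith))
  rw [← mul_div_assoc, le_div_iff₀ hden] at h
  nlinarith [mul_pos hDpos hDpos]
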